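/- Let C ⊆ ℝ^m be a closed convex cone with C ≠ {0}, D ⊆ ℝ^n a closed convex cone, G ∈ ℝ^{n×m} a standard Gaussian matrix, g ∈ ℝ^m, g' ∈ ℝ^n independent standard Gaussian vectors, and γ a standard Gaussian real random variable independent of G. Then for every monotonically increasing Borel function f : ℝ → ℝ such that f(‖G‖_{C→D} + γ) and f(‖Proj_D(g')‖ + ‖Proj_C(g)‖) are integrable, E[ f(‖G‖_{C→D} + γ) ] ≤ E[ f(‖Proj_D(g')‖ + ‖Proj_C(g)‖) ]. -/

import Mathlib

open MeasureTheory ProbabilityTheory Metric Set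
open scoped InnerProductSpace
open scoped Classical
open scoped Pointwise

noncomputable section

/-- Euclidean space `ℝ^k`. -/
abbrev Euc (k : ℕ) : Type := EuclideanSpace ℝ (Fin k)

/-- The linear action of a matrix `A ∈ ℝ^{n×m}` on Euclidean space, `x ↦ Ax`. -/
def mulE {m n : ℕ} (A : Matrix (Fin n) (Fin m) ℝ) (x : Euc m) : Euc n :=
  Matrix.toEuclideanLin A x

/-- The metric projection onto a set `S`: the point of `S` closest to `y`
(if a unique closest point characterizing property holds; junk value `0` otherwise). -/
def metricProj {k : ℕ} (S : Set (Euc k)) (y : Euc k) : Euc k :=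
  if h : ∃ z, z ∈ S ∧ ∀ w ∈ S, dist y z ≤ dist y w then h.choose else 0

/-- `C` is a closed convex cone (containing the origin). -/
def IsClosedConvexCone {k : ℕ} (C : Set (Euc k)) : Prop :=
  IsClosed C ∧ Convex ℝ C ∧ (∀ c : ℝ, 0 ≤ c → ∀ x ∈ C, c • x ∈ C) ∧ (0 : Euc k) ∈ C

/-- The polar cone `S° = {z | ⟨x,z⟩ ≤ 0 ∀ x ∈ S}`. -/
def polarCone {k : ℕ} (S : Set (Euc k)) : Set (Euc k) :=
  {z | ∀ x ∈ S, ⟪x, z⟫_ℝ ≤ 0}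

/-- The restricted norm `‖A‖_{C→D} = max_{x ∈ C ∩ S^{m-1}} ‖Proj_D (Ax)‖`. -/
def resNorm {m n : ℕ} (C : Set (Euc m)) (D : Set (Euc n)) (A : Matrix (Fin n) (Fin m) ℝ) : ℝ :=
  sSup ((fun x => ‖metricProj D (mulE A x)‖) '' (C ∩ sphere 0 1))

/-- The restricted singular value `σ_{C→D}(A) = min_{x ∈ C ∩ S^{m-1}} ‖Proj_D (Ax)‖`. -/
def resSval {m n : ℕ} (C : Set (Euc m)) (D : Set (Euc n)) (A : Matrix (Fin n) (Fin m) ℝ) : ℝ :=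
  sInf ((fun x => ‖metricProj D (mulE A x)‖) '' (C ∩ sphere 0 1))

/-- The restricted norm for arbitrary (not necessarily closed) cones:
`‖B‖_{K→K'} = sup { ⟨Bx, y⟩ : x ∈ K ∩ B^ℓ, y ∈ K' ∩ B^p }`. -/
def resNormGen {l p : ℕ} (K : Set (Euc l)) (K' : Set (Euc p))
    (B : Matrix (Fin p) (Fin l) ℝ) : ℝ :=
  sSup (Set.image2 (fun x y => ⟪mulE B x, y⟫_ℝ) (K ∩ closedBall 0 1) (K' ∩ closedBall 0 1))

/-- The operator (spectral) norm of a matrix. -/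
def opNorm {m n : ℕ} (A : Matrix (Fin n) (Fin m) ℝ) : ℝ :=
  ‖LinearMap.toContinuousLinearMap (Matrix.toEuclideanLin A)‖

/-- The standard Gaussian measure on `ℝ^k` (i.i.d. N(0,1) coordinates). -/
def stdGaussianE (k : ℕ) : Measure (Euc k) :=
  Measure.map (⇑(EuclideanSpace.equiv (Fin k) ℝ).symm)
    (Measure.pi fun _ : Fin k => gaussianReal 0 1)

/-- The standard Gaussian measure on `n × m` arrays (i.i.d. N(0,1) entries). -/
def stdGaussianPi (n m : ℕ) : Measure (Fin n → Fin m → ℝ) :=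
  Measure.pi fun _ : Fin n => Measure.pi fun _ : Fin m => gaussianReal 0 1

/-- The support function `h_K(x) = sup_{z ∈ K} ⟨x, z⟩`. -/
def suppFn {k : ℕ} (K : Set (Euc k)) (x : Euc k) : ℝ := sSup ((fun z => ⟪x, z⟫_ℝ) '' K)

/-- The capped-angle cosine `cos d̄(X,Y) = max{⟨x,y⟩ : x ∈ X ∩ B, y ∈ Y ∩ B}`. -/
def cosAng {k : ℕ} (X Y : Set (Euc k)) : ℝ :=
  sSup (Set.image2 (fun x y => ⟪x, y⟫_ℝ) (X ∩ closedBall 0 1) (Y ∩ closedBall 0 1))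

/-- `sin d̄(X,Y) = √(1 - cos d̄(X,Y)²)`. -/
def sinAng {k : ℕ} (X Y : Set (Euc k)) : ℝ := Real.sqrt (1 - cosAng X Y ^ 2)

/-- The Kronecker (tensor) product `x ⊗ y ∈ ℝ^{mn}`. -/
def kron {m n : ℕ} (x : Euc m) (y : Euc n) : EuclideanSpace ℝ (Fin m × Fin n) :=
  (EuclideanSpace.equiv (Fin m × Fin n) ℝ).symm (fun p => x p.1 * y p.2)

/-- The primal feasible set `𝒫(C,D) = {A | ∃ x ∈ C \ {0}, Ax ∈ D°}`. -/
def primalSet {m n : ℕ} (C : Set (Euc m)) (D : Set (Euc n)) :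
    Set (Matrix (Fin n) (Fin m) ℝ) :=
  {A | ∃ x ∈ C, x ≠ 0 ∧ mulE A x ∈ polarCone D}

/-- The dual feasible set `𝒟(C,D) = {A | ∃ y ∈ D \ {0}, -Aᵀy ∈ C°}`. -/
def dualSet {m n : ℕ} (C : Set (Euc m)) (D : Set (Euc n)) :
    Set (Matrix (Fin n) (Fin m) ℝ) :=
  {A | ∃ y ∈ D, y ≠ 0 ∧ -(mulE A.transpose y) ∈ polarCone C}

/-- `K₂` is a `0`-contraction of `K₁`: there are generating sets `M₁` of `K₁`, `M₂` of `K₂`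
(i.e. `Kᵢ` is the closed convex hull of `Mᵢ`) and a surjection `φ : M₁ → M₂` that is
`1`-Lipschitz and norm-nonincreasing. -/
def IsZeroContractionOf {E₁ E₂ : Type*} [NormedAddCommGroup E₁] [NormedSpace ℝ E₁]
    [NormedAddCommGroup E₂] [NormedSpace ℝ E₂] (K₁ : Set E₁) (K₂ : Set E₂) : Prop :=
  ∃ (M₁ : Set E₁) (M₂ : Set E₂) (φ : E₁ → E₂),
    closure (convexHull ℝ M₁) = K₁ ∧ closure (convexHull ℝ M₂) = K₂ ∧
    φ '' M₁ = M₂ ∧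
    (∀ x ∈ M₁, ∀ x' ∈ M₁, ‖φ x - φ x'‖ ≤ ‖x - x'‖) ∧
    (∀ x ∈ M₁, ‖φ x‖ ≤ ‖x‖)

/-- The pair `(x, y)` regarded as an element of the Euclidean (ℓ²) product. -/
def pairL2 {m n : ℕ} (x : Euc m) (y : Euc n) : WithLp 2 (Euc m × Euc n) :=
  (WithLp.equiv 2 (Euc m × Euc n)).symm (x, y)

/-- The product `K × K'` as a subset of the Euclidean (ℓ²) product space. -/
def prodL2 {m n : ℕ} (K : Set (Euc m)) (K' : Set (Euc n)) : Set (WithLp 2 (Euc m × Euc n)) :=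
  {q | ((WithLp.equiv 2 (Euc m × Euc n)) q).1 ∈ K ∧ ((WithLp.equiv 2 (Euc m × Euc n)) q).2 ∈ K'}


/-- Stein's identity for the standard Gaussian measure on `ℝ`. -/
theorem integral_id_mul_gaussianReal {h h' : ℝ → ℝ} {B : ℝ}
    (hd : ∀ x, HasDerivAt h (h' x) x) (hc : Continuous h')
    (hB : ∀ x, |h x| ≤ B) (hB' : ∀ x, |h' x| ≤ B) :
    ∫ x, x * h x ∂(gaussianReal 0 1) = ∫ x, h' x ∂(gaussianReal 0 1) := by
  have hcont : Continuous h := continuous_iff_continuousAt.2 fun x => (hd x).continuousAt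
  have hpdf : ∀ x, HasDerivAt (gaussianPDFReal 0 1) (-(x * gaussianPDFReal 0 1 x)) x := by
    intro x
    rw [gaussianPDFReal_def]
    have h1 : HasDerivAt (fun x : ℝ => -(x - 0) ^ 2 / (2 * ((1 : NNReal) : ℝ))) (-x) x := by
      have := (((hasDerivAt_id x).sub_const 0).pow 2).neg.div_const (2 * ((1 : NNReal) : ℝ))
      refine this.congr_deriv ?_
      simp
      ring
    refine (h1.exp.const_mul _).congr_deriv ?_
    ring
  have hi0 : Integrable (gaussianPDFReal 0 1) := integrable_gaussianPDFReal 0 1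
  have hi1 : Integrable (fun x => x * gaussianPDFReal 0 1 x) := by
    have h1 : Integrable (fun x : ℝ => x * Real.exp (-(1 / 2) * x ^ 2)) :=
      integrable_mul_exp_neg_mul_sq (by norm_num)
    refine (h1.const_mul (Real.sqrt (2 * Real.pi))⁻¹).congr (ae_of_all _ fun x => ?_)
    simp only [gaussianPDFReal_def, NNReal.coe_one, mul_one, sub_zero]
    rw [show -(1 / 2) * x ^ 2 = -x ^ 2 / 2 by ring]
    ring
  have hpc : Continuous (gaussianPDFReal 0 1) :=
    continuous_iff_continuousAt.2 fun x => (hpdf x).continuousAt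
  have key := integral_mul_deriv_eq_deriv_mul_of_integrable (u := h) (u' := h')
    (v := gaussianPDFReal 0 1) (v' := fun x => -(x * gaussianPDFReal 0 1 x))
    (fun x _ => hd x) (fun x _ => hpdf x)
    (hi1.neg.bdd_mul hcont.aestronglyMeasurable (ae_of_all _ hB))
    (hi0.bdd_mul hc.aestronglyMeasurable (ae_of_all _ hB'))
    (hi0.bdd_mul hcont.aestronglyMeasurable (ae_of_all _ hB))
  rw [integral_gaussianReal_eq_integral_smul one_ne_zero,
    integral_gaussianReal_eq_integral_smul one_ne_zero]
  simp only [smul_eq_mul]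
  have e1 : ∫ x, gaussianPDFReal 0 1 x * (x * h x) =
      -∫ x, h x * -(x * gaussianPDFReal 0 1 x) := by
    rw [← integral_neg]
    congr 1 with x
    ring
  rw [e1, key, neg_neg]
  congr 1 with x
  ring

/-- The standard Gaussian product measure on `κ → ℝ`. -/
abbrev gaussianPi (κ : Type*) [Fintype κ] : Measure (κ → ℝ) :=
  Measure.pi fun _ : κ => gaussianReal 0 1

/-- Resampling one coordinate preserves the standard Gaussian product measure. -/
theorem measurePreserving_update {κ : Type*} [Fintype κ] (k : κ) :
    MeasurePreserving (fun p : (κ → ℝ) × ℝ => Function.update p.1 k p.2)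
      ((gaussianPi κ).prod (gaussianReal 0 1)) (gaussianPi κ) := by
  have hm : Measurable (fun p : (κ → ℝ) × ℝ => Function.update p.1 k p.2) := by
    refine measurable_pi_lambda _ fun j => ?_
    by_cases hj : j = k
    · subst hj
      simpa using measurable_snd
    · simp only [Function.update_of_ne hj]
      fun_prop
  refine ⟨hm, (Measure.pi_eq fun s hs => ?_).symm⟩
  rw [Measure.map_apply hm (MeasurableSet.univ_pi hs)]
  have hpre : (fun p : (κ → ℝ) × ℝ => Function.update p.1 k p.2) ⁻¹' (univ.pi s) =
      (univ.pi (Function.update s k univ)) ×ˢ s k := by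
    ext ⟨w, t⟩
    simp only [mem_preimage, mem_pi, mem_univ, true_imp_iff, mem_prod]
    constructor
    · intro h
      refine ⟨fun j => ?_, by simpa using h k⟩
      by_cases hj : j = k
      · subst hj; simp
      · simpa [Function.update_of_ne hj] using h j
    · rintro ⟨h1, h2⟩ j
      by_cases hj : j = k
      · subst hj; simpa using h2
      · simpa [Function.update_of_ne hj] using h1 j
  rw [hpre, Measure.prod_prod, Measure.pi_pi,
    ← Finset.mul_prod_erase _ _ (Finset.mem_univ k),
    ← Finset.mul_prod_erase _ (fun i => gaussianReal 0 1 (s i)) (Finset.mem_univ k)]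
  simp only [Function.update_self, measure_univ, one_mul]
  rw [mul_comm]
  congr 1
  refine Finset.prod_congr rfl fun j hj => ?_
  rw [Function.update_of_ne (Finset.ne_of_mem_erase hj)]

theorem integrable_eval_gaussianPi {κ : Type*} [Fintype κ] (k : κ) :
    Integrable (fun w : κ → ℝ => w k) (gaussianPi κ) := by
  have h := (memLp_id_gaussianReal (μ := 0) (v := 1) 1).integrable le_rfl
  exact (measurePreserving_eval (fun _ : κ => gaussianReal 0 1) k).integrable_comp_of_integrable h

/-- Stein's identity for the standard Gaussian product measure. -/
theorem integral_eval_mul_gaussianPi {κ : Type*} [Fintype κ] (k : κ)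
    {H H' : (κ → ℝ) → ℝ} {B : ℝ} (hH : Continuous H) (hH' : Continuous H')
    (hd : ∀ w t, HasDerivAt (fun s => H (Function.update w k s)) (H' (Function.update w k t)) t)
    (hB : ∀ w, |H w| ≤ B) (hB' : ∀ w, |H' w| ≤ B) :
    ∫ w, w k * H w ∂(gaussianPi κ) = ∫ w, H' w ∂(gaussianPi κ) := by
  have mp := measurePreserving_update (κ := κ) k
  have i1 : Integrable (fun w : κ → ℝ => w k * H w) (gaussianPi κ) :=
    (integrable_eval_gaussianPi k).mul_bdd hH.aestronglyMeasurable (ae_of_all _ hB)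
  have i2 : Integrable H' (gaussianPi κ) :=
    Integrable.of_bound hH'.aestronglyMeasurable B (ae_of_all _ hB')
  have resample : ∀ G : (κ → ℝ) → ℝ, Integrable G (gaussianPi κ) →
      ∫ w, G w ∂(gaussianPi κ) =
        ∫ w, ∫ t, G (Function.update w k t) ∂(gaussianReal 0 1) ∂(gaussianPi κ) := by
    intro G hG
    rw [← integral_prod (fun p : (κ → ℝ) × ℝ => G (Function.update p.1 k p.2))
      (mp.integrable_comp_of_integrable hG)]
    conv_lhs => rw [← mp.map_eq]
    exact integral_map mp.aemeasurable (by rw [mp.map_eq]; exact hG.aestronglyMeasurable)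
  rw [resample _ i1, resample _ i2]
  congr 1 with w
  simp only [Function.update_self]
  exact integral_id_mul_gaussianReal (hd w)
    (hH'.comp (continuous_const.update k continuous_id)) (fun _ => hB _) (fun _ => hB' _)

/-- The random vector with coefficient matrix `c`, as a function of the Gaussian coordinates. -/
def linComb {I κ : Type*} [Fintype κ] (c : I → κ → ℝ) (w : κ → ℝ) : I → ℝ :=
  fun i => ∑ k, c i k * w k

theorem continuous_linComb {I κ : Type*} [Fintype κ] (c : I → κ → ℝ) :
    Continuous (linComb c) := by
  unfold linComb
  fun_prop

theorem hasDerivAt_comp_of_partials {I : Type*} [Fintype I] {H : (I → ℝ) → ℝ}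
    {H₁ : I → (I → ℝ) → ℝ}
    (hd : ∀ x, HasFDerivAt H (∑ j, H₁ j x • ContinuousLinearMap.proj (R := ℝ) j) x)
    {z : ℝ → I → ℝ} {z' : I → ℝ} {t : ℝ} (hz : ∀ i, HasDerivAt (fun s => z s i) (z' i) t) :
    HasDerivAt (fun s => H (z s)) (∑ j, H₁ j (z t) * z' j) t := by
  have h := (hd (z t)).comp_hasDerivAt t (hasDerivAt_pi.2 hz)
  refine h.congr_deriv ?_
  simp

/-- Gaussian integration by parts for a function of linear combinations of the coordinates. -/
theorem integral_eval_mul_comp_linComb {I κ : Type*} [Fintype I] [Fintype κ] (c : I → κ → ℝ)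
    (k : κ) {H : (I → ℝ) → ℝ} {H₁ : I → (I → ℝ) → ℝ} {B : ℝ}
    (hd : ∀ x, HasFDerivAt H (∑ j, H₁ j x • ContinuousLinearMap.proj (R := ℝ) j) x)
    (hc : ∀ j, Continuous (H₁ j)) (hB : ∀ x, |H x| ≤ B) (hB₁ : ∀ j x, |H₁ j x| ≤ B) :
    ∫ w, w k * H (linComb c w) ∂(gaussianPi κ) =
      ∑ j, c j k * ∫ w, H₁ j (linComb c w) ∂(gaussianPi κ) := by
  have hH : Continuous H := continuous_iff_continuousAt.2 fun x => (hd x).continuousAt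
  have hZ := continuous_linComb c
  have hcont : ∀ j, Continuous fun w => H₁ j (linComb c w) := fun j => (hc j).comp hZ
  have hint : ∀ j, Integrable (fun w => H₁ j (linComb c w)) (gaussianPi κ) := fun j =>
    Integrable.of_bound (hcont j).aestronglyMeasurable B (ae_of_all _ fun _ => hB₁ j _)
  have hbd : ∀ w, |∑ j, H₁ j (linComb c w) * c j k| ≤ ∑ j, B * |c j k| := by
    intro w
    refine (Finset.abs_sum_le_sum_abs _ _).trans (Finset.sum_le_sum fun j _ => ?_)
    rw [abs_mul]
    exact mul_le_mul_of_nonneg_right (hB₁ j _) (abs_nonneg _)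
  rw [integral_eval_mul_gaussianPi k (H := fun w => H (linComb c w))
    (H' := fun w => ∑ j, H₁ j (linComb c w) * c j k) (B := max B (∑ j, B * |c j k|))
    (hH.comp hZ) (by fun_prop) ?_ (fun w => (hB _).trans (le_max_left _ _))
    (fun w => (hbd w).trans (le_max_right _ _))]
  · rw [integral_finsetSum _ fun j _ => (hint j).mul_const _]
    refine Finset.sum_congr rfl fun j _ => ?_
    rw [integral_mul_const, mul_comm]
  · intro w t
    refine hasDerivAt_comp_of_partials hd (z := fun s => linComb c (Function.update w k s)) ?_
    intro i
    have h := HasDerivAt.fun_sum (u := Finset.univ) fun l _ =>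
      ((hasDerivAt_pi.1 (hasDerivAt_update w k t)) l).const_mul (c i l)
    refine h.congr_deriv ?_
    simp [Pi.single_apply]

/-- Gaussian interpolation: if two centered Gaussian vectors have covariances such that each
increment of the covariance has the sign of the corresponding second partial derivative of `F`,
their expectations of `F` compare. -/
theorem integral_comp_linComb_le {I κ : Type*} [Fintype I] [Fintype κ] (a b : I → κ → ℝ)
    {F : (I → ℝ) → ℝ} {F₁ : I → (I → ℝ) → ℝ} {F₂ : I → I → (I → ℝ) → ℝ} {B : ℝ}
    (hF : ∀ x, HasFDerivAt F (∑ j, F₁ j x • ContinuousLinearMap.proj (R := ℝ) j) x)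
    (hF₁ : ∀ i x, HasFDerivAt (F₁ i) (∑ j, F₂ i j x • ContinuousLinearMap.proj (R := ℝ) j) x)
    (hF₂ : ∀ i j, Continuous (F₂ i j)) (hB : ∀ x, |F x| ≤ B) (hB₁ : ∀ i x, |F₁ i x| ≤ B)
    (hB₂ : ∀ i j x, |F₂ i j x| ≤ B) (hab : ∀ i j, ∑ k, a i k * b j k = 0)
    (hcov : ∀ i j x, 0 ≤ (∑ k, a i k * a j k - ∑ k, b i k * b j k) * F₂ i j x) :
    ∫ w, F (linComb b w) ∂(gaussianPi κ) ≤ ∫ w, F (linComb a w) ∂(gaussianPi κ) := by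
  set c : ℝ → I → κ → ℝ := fun θ i k => Real.cos θ * a i k + Real.sin θ * b i k with hc
  set c' : ℝ → I → κ → ℝ := fun θ i k => -Real.sin θ * a i k + Real.cos θ * b i k with hc'
  have hFc : Continuous F := continuous_iff_continuousAt.2 fun x => (hF x).continuousAt
  have hF₁c : ∀ i, Continuous (F₁ i) := fun i =>
    continuous_iff_continuousAt.2 fun x => (hF₁ i x).continuousAt
  have hint₁ : ∀ θ i k, Integrable (fun w => w k * F₁ i (linComb (c θ) w)) (gaussianPi κ) :=
    fun θ i k => (integrable_eval_gaussianPi k).mul_bdd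
      ((hF₁c i).comp (continuous_linComb _)).aestronglyMeasurable (ae_of_all _ fun _ => hB₁ i _)
  have hlc : ∀ θ w i, HasDerivAt (fun s => linComb (c s) w i) (linComb (c' θ) w i) θ := by
    intro θ w i
    refine HasDerivAt.fun_sum fun k _ => HasDerivAt.mul_const ?_ _
    exact ((Real.hasDerivAt_cos θ).mul_const _).add ((Real.hasDerivAt_sin θ).mul_const _)
  have hc'bd : ∀ θ i k, |c' θ i k| ≤ |a i k| + |b i k| := by
    intro θ i k
    refine (abs_add_le _ _).trans (add_le_add ?_ ?_)
    · rw [abs_mul, abs_neg]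
      exact mul_le_of_le_one_left (abs_nonneg _) (Real.abs_sin_le_one θ)
    · rw [abs_mul]
      exact mul_le_of_le_one_left (abs_nonneg _) (Real.abs_cos_le_one θ)
  have hderiv : ∀ θ, HasDerivAt (fun s => ∫ w, F (linComb (c s) w) ∂(gaussianPi κ))
      (∫ w, ∑ i, F₁ i (linComb (c θ) w) * linComb (c' θ) w i ∂(gaussianPi κ)) θ := by
    intro θ
    refine (hasDerivAt_integral_of_dominated_loc_of_deriv_le
      (F := fun s w => F (linComb (c s) w))
      (F' := fun s w => ∑ i, F₁ i (linComb (c s) w) * linComb (c' s) w i)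
      (bound := fun w => ∑ i, B * ∑ k, (|a i k| + |b i k|) * |w k|) Filter.univ_mem
      (Filter.Eventually.of_forall fun s =>
        (hFc.comp (continuous_linComb _)).aestronglyMeasurable)
      (Integrable.of_bound (hFc.comp (continuous_linComb _)).aestronglyMeasurable B
        (ae_of_all _ fun _ => hB _)) ?_ (ae_of_all _ fun w s _ => ?_) ?_
      (ae_of_all _ fun w s _ => hasDerivAt_comp_of_partials hF (hlc s w))).2
    · refine Continuous.aestronglyMeasurable (continuous_finsetSum _ fun i _ => ?_)
      exact ((hF₁c i).comp (continuous_linComb _)).mul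
        ((continuous_apply i).comp (continuous_linComb _))
    · refine (Finset.abs_sum_le_sum_abs _ _).trans (Finset.sum_le_sum fun i _ => ?_)
      rw [abs_mul]
      refine mul_le_mul (hB₁ i _) ?_ (abs_nonneg _) ((abs_nonneg _).trans (hB₁ i 0))
      refine (Finset.abs_sum_le_sum_abs _ _).trans (Finset.sum_le_sum fun k _ => ?_)
      rw [abs_mul]
      exact mul_le_mul_of_nonneg_right (hc'bd s i k) (abs_nonneg _)
    · exact integrable_finsetSum _ fun i _ => (integrable_finsetSum _ fun k _ =>
        (integrable_eval_gaussianPi k).abs.const_mul _).const_mul _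
  have hval : ∀ θ, ∫ w, ∑ i, F₁ i (linComb (c θ) w) * linComb (c' θ) w i ∂(gaussianPi κ) =
      -(Real.sin θ * Real.cos θ * ∑ i, ∑ j, ∫ w,
        (∑ k, a i k * a j k - ∑ k, b i k * b j k) * F₂ i j (linComb (c θ) w)
          ∂(gaussianPi κ)) := by
    intro θ
    have e1 : ∀ w : κ → ℝ, ∑ i, F₁ i (linComb (c θ) w) * linComb (c' θ) w i =
        ∑ i, ∑ k, c' θ i k * (w k * F₁ i (linComb (c θ) w)) := by
      intro w
      refine Finset.sum_congr rfl fun i _ => ?_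
      rw [show linComb (c' θ) w i = ∑ k, c' θ i k * w k from rfl, Finset.mul_sum]
      exact Finset.sum_congr rfl fun k _ => by ring
    simp_rw [e1]
    rw [integral_finsetSum _ fun i _ => integrable_finsetSum _ fun k _ =>
      (hint₁ θ i k).const_mul _, Finset.mul_sum, ← Finset.sum_neg_distrib]
    refine Finset.sum_congr rfl fun i _ => ?_
    rw [integral_finsetSum _ fun k _ => (hint₁ θ i k).const_mul _]
    simp_rw [integral_const_mul]
    simp_rw [integral_eval_mul_comp_linComb (c θ) _ (hF₁ i) (hF₂ i) (hB₁ i) (hB₂ i),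
      Finset.mul_sum]
    rw [Finset.sum_comm, ← Finset.sum_neg_distrib]
    refine Finset.sum_congr rfl fun j _ => ?_
    set J := ∫ w, F₂ i j (linComb (c θ) w) ∂(gaussianPi κ)
    have e2 : ∑ k, c' θ i k * c θ j k =
        -(Real.sin θ * Real.cos θ * (∑ k, a i k * a j k - ∑ k, b i k * b j k)) := by
      have e3 : ∀ k, c' θ i k * c θ j k =
          -(Real.sin θ * Real.cos θ) * (a i k * a j k) +
          Real.sin θ * Real.cos θ * (b i k * b j k) +
          -(Real.sin θ * Real.sin θ) * (a i k * b j k) +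
          Real.cos θ * Real.cos θ * (a j k * b i k) := fun k => by simp only [hc, hc']; ring
      simp_rw [e3, Finset.sum_add_distrib, ← Finset.mul_sum, hab]
      ring
    calc ∑ k, c' θ i k * (c θ j k * J) = (∑ k, c' θ i k * c θ j k) * J := by
          rw [Finset.sum_mul]
          exact Finset.sum_congr rfl fun k _ => by ring
      _ = _ := by rw [e2]; ring
  have hanti : AntitoneOn (fun s => ∫ w, F (linComb (c s) w) ∂(gaussianPi κ))
      (Icc 0 (Real.pi / 2)) := by
    refine antitoneOn_of_deriv_nonpos (convex_Icc _ _)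
      (fun s _ => (hderiv s).continuousAt.continuousWithinAt)
      (fun s _ => (hderiv s).differentiableAt.differentiableWithinAt) fun s hs => ?_
    rw [interior_Icc] at hs
    rw [(hderiv s).deriv, hval, neg_nonpos]
    refine mul_nonneg (mul_nonneg ?_ ?_) (Finset.sum_nonneg fun i _ =>
      Finset.sum_nonneg fun j _ => integral_nonneg fun w => hcov i j _)
    · exact Real.sin_nonneg_of_nonneg_of_le_pi hs.1.le (by linarith [hs.2, Real.pi_pos])
    · exact Real.cos_nonneg_of_neg_pi_div_two_le_of_le (by linarith [hs.1, Real.pi_pos]) hs.2.le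
  have h := hanti (left_mem_Icc.2 (by positivity)) (right_mem_Icc.2 (by positivity))
    (by positivity : (0 : ℝ) ≤ Real.pi / 2)
  simpa [hc] using h

/-- The product function `x ↦ ∏ l, g l (x l)`. -/
def prodFn {I : Type*} [Fintype I] (g : I → ℝ → ℝ) (x : I → ℝ) : ℝ := ∏ l, g l (x l)

theorem hasFDerivAt_prodFn {I : Type*} [Fintype I] {g : I → ℝ → ℝ}
    (hg : ∀ l, Differentiable ℝ (g l)) (x : I → ℝ) :
    HasFDerivAt (prodFn g) (∑ j, prodFn (Function.update g j (deriv (g j))) x •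
      ContinuousLinearMap.proj (R := ℝ) (φ := fun _ : I => ℝ) j) x := by
  have h := HasFDerivAt.finsetProd (u := Finset.univ) (x := x)
    (g := fun l (x : I → ℝ) => g l (x l))
    (g' := fun l => deriv (g l) (x l) • ContinuousLinearMap.proj (R := ℝ) (φ := fun _ : I => ℝ) l) fun l _ =>
      ((hg l (x l)).hasDerivAt.comp_hasFDerivAt x
        (ContinuousLinearMap.proj (R := ℝ) (φ := fun _ : I => ℝ) l).hasFDerivAt)
  have e : prodFn g = fun x => ∏ l, g l (x l) := rfl
  rw [e]
  refine HasFDerivAt.congr_fderiv (by simpa [Finset.prod_fn] using h) ?_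
  refine Finset.sum_congr rfl fun j _ => ?_
  rw [prodFn, ← Finset.prod_erase_mul _ _ (Finset.mem_univ j), smul_smul, Function.update_self]
  congr 2
  refine Finset.prod_congr rfl fun l hl => ?_
  rw [Function.update_of_ne (Finset.ne_of_mem_erase hl)]

theorem abs_prodFn_le {I : Type*} [Fintype I] {g : I → ℝ → ℝ} {B : ℝ}
    (hg : ∀ l x, |g l x| ≤ B) (x : I → ℝ) : |prodFn g x| ≤ B ^ Fintype.card I := by
  rw [prodFn, Finset.abs_prod]
  refine (Finset.prod_le_prod (fun _ _ => abs_nonneg _) fun l _ => hg l (x l)).trans ?_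
  simp

theorem continuous_prodFn {I : Type*} [Fintype I] {g : I → ℝ → ℝ}
    (hg : ∀ l, Continuous (g l)) : Continuous (prodFn g) :=
  continuous_finsetProd _ fun l _ => (hg l).comp (continuous_apply l)

/-- A smooth nonincreasing cutoff with bounded derivatives. -/
theorem exists_antitone_cutoff (t : ℝ) {ε : ℝ} (hε : 0 < ε) :
    ∃ φ : ℝ → ℝ, ContDiff ℝ 2 φ ∧ Antitone φ ∧ (∀ x, 0 ≤ φ x) ∧ (∀ x, φ x ≤ 1) ∧
      (∀ x ≤ t, φ x = 1) ∧ (∀ x, t + ε ≤ x → φ x = 0) ∧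
      ∃ B, ∀ x, |φ x| ≤ B ∧ |deriv φ x| ≤ B ∧ |deriv (deriv φ) x| ≤ B := by
  set φ : ℝ → ℝ := fun x => Real.smoothTransition ((t + ε - x) / ε) with hφ
  have h1 : ∀ x ≤ t, φ x = 1 := fun x hx =>
    Real.smoothTransition.one_of_one_le (by rw [le_div_iff₀ hε]; linarith)
  have h0 : ∀ x, t + ε ≤ x → φ x = 0 := fun x hx =>
    Real.smoothTransition.zero_of_nonpos (div_nonpos_of_nonpos_of_nonneg (by linarith) hε.le)
  have hsmooth : ContDiff ℝ 2 φ := by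
    have : ContDiff ℝ 2 Real.smoothTransition := Real.smoothTransition.contDiff (n := 2)
    exact this.comp (by fun_prop)
  have hd : ContDiff ℝ 1 (deriv φ) := hsmooth.iterate_deriv' 1 1
  have hdd : Continuous (deriv (deriv φ)) := hd.continuous_deriv le_rfl
  have hcs : HasCompactSupport (deriv φ) := by
    refine HasCompactSupport.intro (isCompact_Icc (a := t) (b := t + ε)) fun x hx => ?_
    rw [mem_Icc, not_and_or, not_le, not_le] at hx
    rcases hx with hx | hx
    · have : φ =ᶠ[nhds x] fun _ => 1 := by
        filter_upwards [Iio_mem_nhds hx] with y hy using h1 y (le_of_lt hy)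
      rw [this.deriv_eq, deriv_const]
    · have : φ =ᶠ[nhds x] fun _ => 0 := by
        filter_upwards [Ioi_mem_nhds hx] with y hy using h0 y (le_of_lt hy)
      rw [this.deriv_eq, deriv_const]
  obtain ⟨B₁, hB₁⟩ := hcs.exists_bound_of_continuous hd.continuous
  obtain ⟨B₂, hB₂⟩ := hcs.deriv.exists_bound_of_continuous hdd
  refine ⟨φ, hsmooth, ?_, fun _ => Real.smoothTransition.nonneg _,
    fun _ => Real.smoothTransition.le_one _, h1, h0, max 1 (max B₁ B₂), fun x => ⟨?_, ?_, ?_⟩⟩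
  · intro x y hxy
    refine Real.smoothTransition.monotone ?_
    gcongr
  · rw [abs_of_nonneg (Real.smoothTransition.nonneg _)]
    exact (Real.smoothTransition.le_one _).trans (le_max_left _ _)
  · exact (hB₁ x).trans ((le_max_left _ _).trans (le_max_right _ _))
  · exact (hB₂ x).trans ((le_max_right _ _).trans (le_max_right _ _))

/-- **Slepian's lemma**, smoothed form. -/
theorem integral_prod_linComb_le {I κ : Type*} [Fintype I] [Fintype κ] (a b : I → κ → ℝ)
    (hab : ∀ i j, ∑ k, a i k * b j k = 0) (hvar : ∀ i, ∑ k, a i k * a i k = ∑ k, b i k * b i k)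
    (hcov : ∀ i j, ∑ k, b i k * b j k ≤ ∑ k, a i k * a j k)
    {φ : ℝ → ℝ} {B : ℝ} (hφ : ContDiff ℝ 2 φ) (hanti : Antitone φ) (hnn : ∀ x, 0 ≤ φ x)
    (hB : ∀ x, |φ x| ≤ B ∧ |deriv φ x| ≤ B ∧ |deriv (deriv φ) x| ≤ B) :
    ∫ w, prodFn (fun _ => φ) (linComb b w) ∂(gaussianPi κ) ≤
      ∫ w, prodFn (fun _ => φ) (linComb a w) ∂(gaussianPi κ) := by
  have hd : ContDiff ℝ 1 (deriv φ) := hφ.iterate_deriv' 1 1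
  have hdd : Continuous (deriv (deriv φ)) := hd.continuous_deriv le_rfl
  have hφd : Differentiable ℝ φ := hφ.differentiable (by norm_num)
  have hφ'd : Differentiable ℝ (deriv φ) := hd.differentiable (by norm_num)
  set g₀ : I → ℝ → ℝ := fun _ => φ
  set g₁ : I → I → ℝ → ℝ := fun i => Function.update g₀ i (deriv (g₀ i)) with hg₁
  set g₂ : I → I → I → ℝ → ℝ := fun i j => Function.update (g₁ i) j (deriv (g₁ i j)) with hg₂
  have cases₁ : ∀ i l, g₁ i l = φ ∨ g₁ i l = deriv φ := by
    intro i l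
    by_cases h : l = i
    · subst h; right; simp [hg₁, g₀]
    · left; simp [hg₁, g₀, Function.update_of_ne h]
  have cases₂ : ∀ i j l, g₂ i j l = φ ∨ g₂ i j l = deriv φ ∨ g₂ i j l = deriv (deriv φ) := by
    intro i j l
    by_cases h : l = j
    · subst h
      simp only [hg₂, Function.update_self]
      rcases cases₁ i l with h | h <;> simp [h]
    · simp only [hg₂, Function.update_of_ne h]
      rcases cases₁ i l with h | h <;> simp [h]
  have diff₁ : ∀ i l, Differentiable ℝ (g₁ i l) := by
    intro i l
    rcases cases₁ i l with h | h <;> rw [h] <;> assumption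
  refine integral_comp_linComb_le a b (F₁ := fun i => prodFn (g₁ i))
    (F₂ := fun i j => prodFn (g₂ i j)) (B := B ^ Fintype.card I)
    (hasFDerivAt_prodFn fun _ => hφd) (fun i => hasFDerivAt_prodFn (diff₁ i))
    (fun i j => continuous_prodFn fun l => ?_) (abs_prodFn_le fun _ x => (hB x).1)
    (fun i => abs_prodFn_le fun l x => ?_) (fun i j => abs_prodFn_le fun l x => ?_) hab
    fun i j x => ?_
  · rcases cases₂ i j l with h | h | h <;> rw [h]
    exacts [hφd.continuous, hφ'd.continuous, hdd]
  · rcases cases₁ i l with h | h <;> rw [h]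
    exacts [(hB x).1, (hB x).2.1]
  · rcases cases₂ i j l with h | h | h <;> rw [h]
    exacts [(hB x).1, (hB x).2.1, (hB x).2.2]
  · by_cases hij : j = i
    · subst hij
      rw [hvar, sub_self, zero_mul]
    · refine mul_nonneg (sub_nonneg.2 (hcov i j)) ?_
      have hi : i ∈ Finset.univ.erase j := Finset.mem_erase.2 ⟨Ne.symm hij, Finset.mem_univ _⟩
      rw [prodFn, ← Finset.mul_prod_erase _ _ (Finset.mem_univ j),
        ← Finset.mul_prod_erase _ _ hi, ← mul_assoc]
      refine mul_nonneg (mul_nonneg_of_nonpos_of_nonpos ?_ ?_) (Finset.prod_nonneg fun l hl => ?_)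
      · simp only [hg₂, hg₁, Function.update_self, Function.update_of_ne hij]
        exact hanti.deriv_nonpos
      · simp only [hg₂, hg₁, Function.update_self, Function.update_of_ne (Ne.symm hij)]
        exact hanti.deriv_nonpos
      · simp only [Finset.mem_erase] at hl
        simp only [hg₂, hg₁, Function.update_of_ne hl.1, Function.update_of_ne hl.2.1]
        exact hnn _

/-- **Slepian's lemma**: of two centered Gaussian vectors with equal variances, the one with
larger covariances has the stochastically smaller maximum. -/
theorem measure_exists_linComb_gt_le {I κ : Type*} [Fintype I] [Fintype κ] (a b : I → κ → ℝ)
    (hab : ∀ i j, ∑ k, a i k * b j k = 0) (hvar : ∀ i, ∑ k, a i k * a i k = ∑ k, b i k * b i k)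
    (hcov : ∀ i j, ∑ k, b i k * b j k ≤ ∑ k, a i k * a j k) (t : ℝ) :
    gaussianPi κ {w | ∃ i, t < linComb a w i} ≤ gaussianPi κ {w | ∃ i, t < linComb b w i} := by
  have hopen : ∀ c : I → κ → ℝ, ∀ s, IsOpen {w | ∃ i, s < linComb c w i} := by
    intro c s
    simp only [ofPred_exists]
    exact isOpen_iUnion fun i =>
      isOpen_lt continuous_const ((continuous_apply i).comp (continuous_linComb c))
  have shifted : ∀ ε > 0, gaussianPi κ {w | ∃ i, t + ε < linComb a w i} ≤
      gaussianPi κ {w | ∃ i, t < linComb b w i} := by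
    intro ε hε
    obtain ⟨φ, hφ, hanti, hnn, hle, h1, h0, B, hB⟩ := exists_antitone_cutoff t hε
    have hmain := integral_prod_linComb_le a b hab hvar hcov hφ hanti hnn hB
    have hint : ∀ c : I → κ → ℝ,
        Integrable (fun w => prodFn (fun _ => φ) (linComb c w)) (gaussianPi κ) := fun c =>
      Integrable.of_bound ((continuous_prodFn fun _ => hφ.continuous).comp
        (continuous_linComb c)).aestronglyMeasurable _
        (ae_of_all _ fun _ => abs_prodFn_le (fun _ x => (hB x).1) _)
    have hbelow : (gaussianPi κ).real {w | ∃ i, t < linComb b w i}ᶜ ≤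
        ∫ w, prodFn (fun _ => φ) (linComb b w) ∂(gaussianPi κ) := by
      rw [← integral_indicator_one (hopen b t).measurableSet.compl]
      refine integral_mono ((integrable_const 1).indicator (hopen b t).measurableSet.compl)
        (hint b) fun w => ?_
      refine indicator_le' (fun w hw => ?_) (fun w _ => Finset.prod_nonneg fun i _ => hnn _) w
      simp only [mem_compl_iff, mem_ofPred_eq, not_exists, not_lt] at hw
      simp [fun i => h1 _ (hw i)]
    have habove : ∫ w, prodFn (fun _ => φ) (linComb a w) ∂(gaussianPi κ) ≤
        (gaussianPi κ).real {w | ∃ i, t + ε < linComb a w i}ᶜ := by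
      rw [← integral_indicator_one (hopen a _).measurableSet.compl]
      refine integral_mono (hint a)
        ((integrable_const 1).indicator (hopen a _).measurableSet.compl) fun w => ?_
      refine le_indicator (fun w _ => Finset.prod_le_one (fun _ _ => hnn _) fun _ _ => hle _)
        (fun w hw => ?_) w
      simp only [mem_compl_iff, not_not, mem_ofPred_eq] at hw
      obtain ⟨i, hi⟩ := hw
      exact (Finset.prod_eq_zero (Finset.mem_univ i) (h0 _ hi.le)).le
    have := (hbelow.trans hmain).trans habove
    rw [probReal_compl_eq_one_sub (hopen b t).measurableSet,
      probReal_compl_eq_one_sub (hopen a _).measurableSet] at this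
    rw [← ENNReal.toReal_le_toReal (measure_ne_top _ _) (measure_ne_top _ _)]
    change (gaussianPi κ).real _ ≤ (gaussianPi κ).real _
    linarith
  have hunion : {w | ∃ i, t < linComb a w i} =
      ⋃ N : ℕ, {w | ∃ i, t + 1 / ((N : ℝ) + 1) < linComb a w i} := by
    ext w
    simp only [mem_ofPred_eq, mem_iUnion]
    constructor
    · rintro ⟨i, hi⟩
      obtain ⟨N, hN⟩ := exists_nat_one_div_lt (sub_pos.2 hi)
      exact ⟨N, i, by linarith⟩
    · rintro ⟨N, i, hi⟩
      exact ⟨i, lt_trans (lt_add_of_pos_right t Nat.one_div_pos_of_nat) hi⟩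
  have hmono : Monotone fun N : ℕ => {w | ∃ i, t + 1 / ((N : ℝ) + 1) < linComb a w i} := by
    rintro N M hNM w ⟨i, hi⟩
    exact ⟨i, lt_of_le_of_lt (add_le_add_right (Nat.one_div_le_one_div (α := ℝ) hNM) t) hi⟩
  rw [hunion, hmono.measure_iUnion]
  exact iSup_le fun N => shifted _ Nat.one_div_pos_of_nat

theorem measure_mono_of_isUpperSet {μ ν : Measure ℝ} [IsFiniteMeasure μ]
    [IsFiniteMeasure ν] (huniv : μ univ = ν univ) (h : ∀ t, μ (Ioi t) ≤ ν (Ioi t)) {U : Set ℝ}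
    (hU : IsUpperSet U) : μ U ≤ ν U := by
  have hIci : ∀ c, μ (Ici c) ≤ ν (Ici c) := by
    intro c
    obtain ⟨u, humono, hult, hulim⟩ := exists_seq_strictMono_tendsto c
    have hinter : Ici c = ⋂ k, Ioi (u k) := by
      ext x
      simp only [mem_Ici, mem_iInter, mem_Ioi]
      exact ⟨fun hx k => (hult k).trans_le hx,
        fun hx => le_of_tendsto' hulim fun k => (hx k).le⟩
    have hanti : Antitone fun k => Ioi (u k) := fun k l hkl =>
      Ioi_subset_Ioi (humono.monotone hkl)
    have lim : ∀ ρ : Measure ℝ, IsFiniteMeasure ρ →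
        Filter.Tendsto (fun k => ρ (Ioi (u k))) Filter.atTop (nhds (ρ (Ici c))) := by
      intro ρ _
      rw [hinter]
      exact tendsto_measure_iInter_atTop (fun _ => measurableSet_Ioi.nullMeasurableSet) hanti
        ⟨0, measure_ne_top _ _⟩
    exact le_of_tendsto_of_tendsto' (lim μ inferInstance) (lim ν inferInstance) fun k => h _
  rcases U.eq_empty_or_nonempty with rfl | hne
  · simp
  by_cases hbdd : BddBelow U
  · have hsub : Ioi (sInf U) ⊆ U := by
      intro x hx
      obtain ⟨y, hy, hyx⟩ := exists_lt_of_csInf_lt hne hx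
      exact hU hyx.le hy
    by_cases hmem : sInf U ∈ U
    · have : U = Ici (sInf U) :=
        Subset.antisymm (fun x hx => csInf_le hbdd hx) fun x hx => hU hx hmem
      rw [this]
      exact hIci _
    · have : U = Ioi (sInf U) := Subset.antisymm (fun x hx =>
        lt_of_le_of_ne (csInf_le hbdd hx) fun e => hmem (e ▸ hx)) hsub
      rw [this]
      exact h _
  · have : U = univ := by
      refine eq_univ_of_forall fun x => ?_
      obtain ⟨y, hy, hyx⟩ := not_bddBelow_iff.1 hbdd x
      exact hU hyx.le hy
    rw [this, huniv]

/-- Stochastic domination implies the comparison of expectations of monotone functions. -/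
theorem integral_mono_of_measure_Ioi_le {μ ν : Measure ℝ} [IsProbabilityMeasure μ]
    [IsProbabilityMeasure ν] (h : ∀ t, μ (Ioi t) ≤ ν (Ioi t)) {f : ℝ → ℝ} (hf : Monotone f)
    (hμ : Integrable f μ) (hν : Integrable f ν) : ∫ x, f x ∂μ ≤ ∫ x, f x ∂ν := by
  have hup : ∀ {U : Set ℝ}, IsUpperSet U → μ U ≤ ν U := fun hU =>
    measure_mono_of_isUpperSet (by simp) h hU
  have hlow : ∀ {L : Set ℝ}, IsLowerSet L → ν L ≤ μ L := by
    intro L hL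
    have hm : MeasurableSet L := hL.ordConnected.measurableSet
    have := hup hL.compl
    rw [prob_compl_eq_one_sub hm, prob_compl_eq_one_sub hm] at this
    rwa [← ENNReal.sub_le_sub_iff_left prob_le_one ENNReal.one_ne_top]
  have layer : ∀ (ρ : Measure ℝ) (g : ℝ → ℝ), Measurable g →
      ∫⁻ x, ENNReal.ofReal (g x) ∂ρ = ∫⁻ t in Ioi 0, ρ {x | t < max (g x) 0} := by
    intro ρ g hg
    rw [← lintegral_eq_lintegral_meas_lt (f := fun x => max (g x) 0) ρ (ae_of_all _ fun x => le_max_right _ _)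
      (hg.max measurable_const).aemeasurable]
    refine lintegral_congr fun x => ?_
    rw [ENNReal.ofReal_max]
    simp
  rw [integral_eq_lintegral_pos_part_sub_lintegral_neg_part hμ,
    integral_eq_lintegral_pos_part_sub_lintegral_neg_part hν]
  refine sub_le_sub (ENNReal.toReal_mono hν.lintegral_lt_top.ne ?_)
    (ENNReal.toReal_mono hμ.neg.lintegral_lt_top.ne ?_)
  · rw [layer _ _ hf.measurable, layer _ _ hf.measurable]
    refine lintegral_mono fun t => hup fun x y hxy (hx : t < max (f x) 0) => ?_
    exact hx.trans_le (max_le_max (hf hxy) le_rfl)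
  · rw [layer _ (fun x => -f x) hf.measurable.neg, layer _ (fun x => -f x) hf.measurable.neg]
    refine lintegral_mono fun t => hlow fun x y hxy (hx : t < max (-f x) 0) => ?_
    exact hx.trans_le (max_le_max (neg_le_neg (hf hxy)) le_rfl)

section ConeProjection

variable {k : ℕ} {D : Set (Euc k)}

theorem metricProj_mem_and_dist_le (hD : IsClosedConvexCone D) (z : Euc k) :
    metricProj D z ∈ D ∧ ∀ w ∈ D, dist z (metricProj D z) ≤ dist z w := by
  have h : ∃ p, p ∈ D ∧ ∀ w ∈ D, dist z p ≤ dist z w := by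
    obtain ⟨p, hp, hdist⟩ := hD.1.exists_infDist_eq_dist ⟨0, hD.2.2.2⟩ z
    exact ⟨p, hp, fun w hw => hdist ▸ infDist_le_dist_of_mem hw⟩
  rw [metricProj, dif_pos h]
  exact h.choose_spec

theorem inner_sub_metricProj_le (hD : IsClosedConvexCone D) (z : Euc k) {w : Euc k}
    (hw : w ∈ D) : ⟪z - metricProj D z, w - metricProj D z⟫_ℝ ≤ 0 := by
  obtain ⟨hp, hle⟩ := metricProj_mem_and_dist_le hD z
  refine (norm_eq_iInf_iff_real_inner_le_zero hD.2.1 hp).1 ?_ w hw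
  have : Nonempty D := ⟨⟨_, hp⟩⟩
  refine le_antisymm (le_ciInf fun w => ?_) (ciInf_le ⟨0, ?_⟩ (⟨_, hp⟩ : D))
  · simpa [dist_eq_norm] using hle w w.2
  · rintro _ ⟨w, rfl⟩
    exact norm_nonneg _

theorem inner_metricProj_self (hD : IsClosedConvexCone D) (z : Euc k) :
    ⟪z, metricProj D z⟫_ℝ = ‖metricProj D z‖ ^ 2 := by
  have hp := (metricProj_mem_and_dist_le hD z).1
  have h0 := inner_sub_metricProj_le hD z hD.2.2.2
  have h2 := inner_sub_metricProj_le hD z (hD.2.2.1 2 (by norm_num) _ hp)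
  rw [two_smul, add_sub_cancel_right, inner_sub_left, real_inner_self_eq_norm_sq] at h2
  rw [zero_sub, inner_neg_right, inner_sub_left, real_inner_self_eq_norm_sq] at h0
  linarith

theorem inner_le_norm_metricProj (hD : IsClosedConvexCone D) (z : Euc k) {w : Euc k}
    (hw : w ∈ D) (hw1 : ‖w‖ ≤ 1) : ⟪z, w⟫_ℝ ≤ ‖metricProj D z‖ := by
  have h := inner_sub_metricProj_le hD z hw
  rw [inner_sub_right, inner_sub_left, inner_sub_left, inner_metricProj_self hD,
    real_inner_self_eq_norm_sq, sub_self, sub_zero, sub_nonpos] at h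
  calc ⟪z, w⟫_ℝ ≤ ⟪metricProj D z, w⟫_ℝ := h
    _ ≤ ‖metricProj D z‖ * ‖w‖ := real_inner_le_norm _ _
    _ ≤ ‖metricProj D z‖ := mul_le_of_le_one_right (norm_nonneg _) hw1

theorem exists_inner_eq_norm_metricProj (hD : IsClosedConvexCone D) (z : Euc k) :
    ∃ w ∈ D ∩ closedBall 0 1, ⟪z, w⟫_ℝ = ‖metricProj D z‖ := by
  refine ⟨‖metricProj D z‖⁻¹ • metricProj D z, ⟨?_, ?_⟩, ?_⟩
  · exact hD.2.2.1 _ (inv_nonneg.2 (norm_nonneg _)) _ (metricProj_mem_and_dist_le hD z).1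
  · rw [mem_closedBall_zero_iff, norm_smul, norm_inv, norm_norm]
    exact inv_mul_le_one
  · rw [inner_smul_right, inner_metricProj_self hD, pow_two, ← mul_assoc]
    exact inv_mul_mul_self _

theorem norm_metricProj_le (hD : IsClosedConvexCone D) (z : Euc k) : ‖metricProj D z‖ ≤ ‖z‖ := by
  obtain ⟨w, hw, he⟩ := exists_inner_eq_norm_metricProj hD z
  rw [← he]
  refine (real_inner_le_norm _ _).trans (mul_le_of_le_one_right (norm_nonneg _) ?_)
  simpa using hw.2

theorem continuous_norm_metricProj (hD : IsClosedConvexCone D) :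
    Continuous fun z => ‖metricProj D z‖ := by
  refine LipschitzWith.continuous (K := 1) (LipschitzWith.of_le_add fun z z' => ?_)
  obtain ⟨w, hw, he⟩ := exists_inner_eq_norm_metricProj hD z
  have hw1 : ‖w‖ ≤ 1 := by simpa using hw.2
  have h1 := inner_le_norm_metricProj hD z' hw.1 hw1
  have h2 : ⟪z - z', w⟫_ℝ ≤ dist z z' := by
    rw [dist_eq_norm]
    exact (real_inner_le_norm _ _).trans (mul_le_of_le_one_right (norm_nonneg _) hw1)
  rw [inner_sub_left] at h2
  rw [← he]
  linarith

end ConeProjection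

theorem exists_unit_mem_cone {m : ℕ} {C : Set (Euc m)} (hC : IsClosedConvexCone C)
    (hCne : C ≠ {0}) : (C ∩ sphere 0 1).Nonempty := by
  have : ∃ x ∈ C, x ≠ 0 := by
    by_contra! h
    exact hCne (Subset.antisymm (fun x hx => h x hx) (singleton_subset_iff.2 hC.2.2.2))
  obtain ⟨x, hx, hx0⟩ := this
  refine ⟨‖x‖⁻¹ • x, hC.2.2.1 _ (inv_nonneg.2 (norm_nonneg _)) _ hx, ?_⟩
  rw [mem_sphere_zero_iff_norm, norm_smul, norm_inv, norm_norm,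
    inv_mul_cancel₀ (norm_ne_zero_iff.2 hx0)]

theorem lt_resNorm_iff {m n : ℕ} {C : Set (Euc m)} {D : Set (Euc n)}
    (hC : IsClosedConvexCone C) (hCne : C ≠ {0}) (hD : IsClosedConvexCone D)
    (A : Matrix (Fin n) (Fin m) ℝ) (t : ℝ) :
    t < resNorm C D A ↔
      ∃ x ∈ C ∩ sphere 0 1, ∃ y ∈ D ∩ closedBall 0 1, t < ⟪mulE A x, y⟫_ℝ := by
  have hbdd : BddAbove ((fun x => ‖metricProj D (mulE A x)‖) '' (C ∩ sphere 0 1)) := by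
    refine ⟨opNorm A, ?_⟩
    rintro _ ⟨x, hx, rfl⟩
    refine (norm_metricProj_le hD _).trans ?_
    have h := (LinearMap.toContinuousLinearMap (Matrix.toEuclideanLin A)).le_opNorm x
    rwa [mem_sphere_zero_iff_norm.1 hx.2, mul_one] at h
  rw [resNorm, lt_csSup_iff hbdd ((exists_unit_mem_cone hC hCne).image _)]
  constructor
  · rintro ⟨_, ⟨x, hx, rfl⟩, hlt⟩
    obtain ⟨y, hy, he⟩ := exists_inner_eq_norm_metricProj hD (mulE A x)
    exact ⟨x, hx, y, hy, he ▸ hlt⟩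
  · rintro ⟨x, hx, y, hy, hlt⟩
    exact ⟨_, mem_image_of_mem _ hx,
      hlt.trans_le (inner_le_norm_metricProj hD _ hy.1 (by simpa using hy.2))⟩

instance (k : ℕ) : IsProbabilityMeasure (stdGaussianE k) :=
  Measure.isProbabilityMeasure_map
    (EuclideanSpace.equiv (Fin k) ℝ).symm.continuous.measurable.aemeasurable

instance (n m : ℕ) : IsProbabilityMeasure (stdGaussianPi n m) := by
  unfold stdGaussianPi
  infer_instance

theorem stdGaussianE_box {k : ℕ} {s : Fin k → Set ℝ} (hs : ∀ i, MeasurableSet (s i)) :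
    stdGaussianE k {x | ∀ i, x i ∈ s i} = ∏ i, gaussianReal 0 1 (s i) := by
  have hm : MeasurableSet {x : Euc k | ∀ i, x i ∈ s i} := by
    rw [ofPred_forall]
    exact MeasurableSet.iInter fun i =>
      (EuclideanSpace.proj (𝕜 := ℝ) i).continuous.measurable (hs i)
  rw [stdGaussianE, Measure.map_apply
    (EuclideanSpace.equiv (Fin k) ℝ).symm.continuous.measurable hm, ← Measure.pi_pi]
  congr 1
  ext x
  simp

/-- Indices of all the Gaussian coordinates: the entries of the matrix, the scalar, and the
entries of the two vectors. -/
abbrev CoordIdx (m n : ℕ) : Type := (Fin n × Fin m ⊕ Unit) ⊕ (Fin n ⊕ Fin m)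

/-- The family of all Gaussian coordinates. -/
def coords {m n : ℕ} (p : ((Fin n → Fin m → ℝ) × ℝ) × (Euc n × Euc m)) : CoordIdx m n → ℝ :=
  Sum.elim (Sum.elim (fun q => p.1.1 q.1 q.2) fun _ => p.1.2) (Sum.elim p.2.1 p.2.2)

theorem measurePreserving_coords (m n : ℕ) :
    MeasurePreserving (coords (m := m) (n := n))
      (((stdGaussianPi n m).prod (gaussianReal 0 1)).prod
        ((stdGaussianE n).prod (stdGaussianE m)))
      (gaussianPi (CoordIdx m n)) := by
  have hm : Measurable (coords (m := m) (n := n)) := by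
    refine measurable_pi_lambda _ ?_
    rintro ((⟨i, j⟩ | u) | (i | j)) <;> simp only [coords, Sum.elim_inl, Sum.elim_inr] <;> fun_prop
  refine ⟨hm, (Measure.pi_eq fun s hs => ?_).symm⟩
  rw [Measure.map_apply hm (MeasurableSet.univ_pi hs)]
  have hpre : coords ⁻¹' (univ.pi s) =
      ((univ.pi fun i => univ.pi fun j => s (.inl (.inl (i, j)))) ×ˢ s (.inl (.inr ()))) ×ˢ
        ({x : Euc n | ∀ i, x i ∈ s (.inr (.inl i))} ×ˢ
          {x : Euc m | ∀ j, x j ∈ s (.inr (.inr j))}) := by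
    ext ⟨⟨A, t⟩, y, x⟩
    simp only [coords, mem_preimage, mem_pi, mem_univ, true_imp_iff, mem_prod, mem_ofPred_eq,
      Sum.forall, Prod.forall, Sum.elim_inl, Sum.elim_inr]
    exact and_congr_left' (and_congr_right' ⟨fun h => h (), fun h _ => h⟩)
  rw [hpre, Measure.prod_prod, Measure.prod_prod, Measure.prod_prod,
    stdGaussianE_box fun i => hs _, stdGaussianE_box fun i => hs _, stdGaussianPi, Measure.pi_pi]
  simp only [Measure.pi_pi, Fintype.prod_sum_type, Fintype.prod_prod_type, Finset.univ_unique,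
    Finset.prod_singleton]

/-- Coefficients of the Gaussian process `⟨Gx, y⟩ + γ`. -/
def matrixCoeff {m n : ℕ} (q : Euc m × Euc n) : CoordIdx m n → ℝ :=
  Sum.elim (Sum.elim (fun r => q.2 r.1 * q.1 r.2) fun _ => 1) fun _ => 0

/-- Coefficients of the Gaussian process `⟨g', y⟩ + ⟨g, x⟩`. -/
def vectorCoeff {m n : ℕ} (q : Euc m × Euc n) : CoordIdx m n → ℝ :=
  Sum.elim (fun _ => 0) (Sum.elim q.2 q.1)

theorem sum_matrixCoeff_mul_coords {m n : ℕ} (q : Euc m × Euc n)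
    (p : ((Fin n → Fin m → ℝ) × ℝ) × (Euc n × Euc m)) :
    ∑ k, matrixCoeff q k * coords p k = ⟪mulE (Matrix.of p.1.1) q.1, q.2⟫_ℝ + p.1.2 := by
  simp only [matrixCoeff, coords, Fintype.sum_sum_type, Fintype.sum_prod_type, Sum.elim_inl,
    Sum.elim_inr, Finset.univ_unique, Finset.sum_singleton, one_mul, zero_mul,
    Finset.sum_const_zero, add_zero]
  congr 1
  simp only [mulE, PiLp.inner_apply, Matrix.toLpLin_apply, Matrix.mulVec, dotProduct,
    Matrix.of_apply, RCLike.inner_apply, conj_trivial, Finset.mul_sum]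
  exact Finset.sum_congr rfl fun i _ => Finset.sum_congr rfl fun j _ => by ring

theorem sum_vectorCoeff_mul_coords {m n : ℕ} (q : Euc m × Euc n)
    (p : ((Fin n → Fin m → ℝ) × ℝ) × (Euc n × Euc m)) :
    ∑ k, vectorCoeff q k * coords p k = ⟪p.2.1, q.2⟫_ℝ + ⟪p.2.2, q.1⟫_ℝ := by
  simp [vectorCoeff, coords, Fintype.sum_sum_type, PiLp.inner_apply]

theorem sum_matrixCoeff_mul_matrixCoeff {m n : ℕ} (q r : Euc m × Euc n) :
    ∑ k, matrixCoeff q k * matrixCoeff r k = ⟪q.1, r.1⟫_ℝ * ⟪q.2, r.2⟫_ℝ + 1 := by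
  simp only [matrixCoeff, Fintype.sum_sum_type, Fintype.sum_prod_type, Sum.elim_inl,
    Sum.elim_inr, Finset.univ_unique, Finset.sum_singleton, one_mul, zero_mul,
    Finset.sum_const_zero, add_zero]
  congr 1
  simp only [PiLp.inner_apply, RCLike.inner_apply, conj_trivial]
  rw [mul_comm, Finset.sum_mul_sum]
  exact Finset.sum_congr rfl fun i _ => Finset.sum_congr rfl fun j _ => by ring

theorem sum_vectorCoeff_mul_vectorCoeff {m n : ℕ} (q r : Euc m × Euc n) :
    ∑ k, vectorCoeff q k * vectorCoeff r k = ⟪q.1, r.1⟫_ℝ + ⟪q.2, r.2⟫_ℝ := by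
  simp [vectorCoeff, Fintype.sum_sum_type, PiLp.inner_apply, mul_comm, add_comm]

theorem sum_matrixCoeff_mul_vectorCoeff {m n : ℕ} (q r : Euc m × Euc n) :
    ∑ k, matrixCoeff q k * vectorCoeff r k = 0 := by
  simp [matrixCoeff, vectorCoeff, Fintype.sum_sum_type]

/-- Slepian's lemma for the processes `⟨Gx, y⟩ + γ` and `⟨g', y⟩ + ⟨g, x⟩`, indexed by finitely
many pairs `(x, y)` of a unit vector and a vector of the unit ball. -/
theorem measure_exists_inner_gt_le {m n : ℕ} {I : Type*} [Fintype I] (s : I → Euc m × Euc n)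
    (hx : ∀ i, ‖(s i).1‖ = 1) (hy : ∀ i, ‖(s i).2‖ ≤ 1) (t : ℝ) :
    ((stdGaussianPi n m).prod (gaussianReal 0 1))
        {p | ∃ i, t < ⟪mulE (Matrix.of p.1) (s i).1, (s i).2⟫_ℝ + p.2} ≤
      ((stdGaussianE n).prod (stdGaussianE m))
        {p | ∃ i, t < ⟪p.1, (s i).2⟫_ℝ + ⟪p.2, (s i).1⟫_ℝ} := by
  have hslep := measure_exists_linComb_gt_le (fun i => matrixCoeff (s i))
    (fun i => vectorCoeff (s i)) (fun i j => sum_matrixCoeff_mul_vectorCoeff _ _) (fun i => ?_)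
    (fun i j => ?_) t
  · have hmp := measurePreserving_coords m n
    have hmeas : ∀ c : I → CoordIdx m n → ℝ,
        NullMeasurableSet {w | ∃ i, t < linComb c w i} (gaussianPi (CoordIdx m n)) := by
      intro c
      rw [ofPred_exists]
      exact (MeasurableSet.iUnion fun i => measurableSet_lt measurable_const
        ((continuous_apply i).comp (continuous_linComb c)).measurable).nullMeasurableSet
    rw [← hmp.measure_preimage (hmeas _), ← hmp.measure_preimage (hmeas _)] at hslep
    have e₁ : coords ⁻¹' {w | ∃ i, t < linComb (fun i => matrixCoeff (s i)) w i} =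
        {p | ∃ i, t < ⟪mulE (Matrix.of p.1) (s i).1, (s i).2⟫_ℝ + p.2} ×ˢ univ := by
      ext p
      simp only [linComb, mem_preimage, mem_ofPred_eq, sum_matrixCoeff_mul_coords, mem_prod,
        mem_univ, and_true]
    have e₂ : coords ⁻¹' {w | ∃ i, t < linComb (fun i => vectorCoeff (s i)) w i} =
        univ ×ˢ {p | ∃ i, t < ⟪p.1, (s i).2⟫_ℝ + ⟪p.2, (s i).1⟫_ℝ} := by
      ext p
      simp only [linComb, mem_preimage, mem_ofPred_eq, sum_vectorCoeff_mul_coords, mem_prod,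
        mem_univ, true_and]
    rwa [e₁, e₂, Measure.prod_prod, Measure.prod_prod, measure_univ, measure_univ, mul_one,
      one_mul] at hslep
  · rw [sum_matrixCoeff_mul_matrixCoeff, sum_vectorCoeff_mul_vectorCoeff,
      real_inner_self_eq_norm_sq, hx]
    ring
  · rw [sum_matrixCoeff_mul_matrixCoeff, sum_vectorCoeff_mul_vectorCoeff]
    have h₁ : ⟪(s i).1, (s j).1⟫_ℝ ≤ 1 := by
      have := real_inner_le_norm (s i).1 (s j).1
      rwa [hx, hx, mul_one] at this
    have h₂ : ⟪(s i).2, (s j).2⟫_ℝ ≤ 1 :=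
      (real_inner_le_norm _ _).trans (mul_le_one₀ (hy i) (norm_nonneg _) (hy j))
    nlinarith [mul_nonneg (sub_nonneg.2 h₁) (sub_nonneg.2 h₂)]

theorem exists_seq_lt_resNorm_add_iff {m n : ℕ} {C : Set (Euc m)} {D : Set (Euc n)}
    (hC : IsClosedConvexCone C) (hCne : C ≠ {0}) (hD : IsClosedConvexCone D) :
    ∃ s : ℕ → Euc m × Euc n, (∀ i, s i ∈ (C ∩ sphere 0 1) ×ˢ (D ∩ closedBall 0 1)) ∧
      ∀ (A : Matrix (Fin n) (Fin m) ℝ) (c t : ℝ),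
        t < resNorm C D A + c ↔ ∃ i, t < ⟪mulE A (s i).1, (s i).2⟫_ℝ + c := by
  set S : Set (Euc m × Euc n) := (C ∩ sphere 0 1) ×ˢ (D ∩ closedBall 0 1)
  obtain ⟨x₀, hx₀⟩ := exists_unit_mem_cone hC hCne
  have : Nonempty S := ⟨⟨(x₀, 0), hx₀, hD.2.2.2, by simp⟩⟩
  refine ⟨fun i => TopologicalSpace.denseSeq S i, fun i => Subtype.coe_prop _, fun A c t => ?_⟩
  rw [← sub_lt_iff_lt_add, lt_resNorm_iff hC hCne hD]
  simp only [← sub_lt_iff_lt_add]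
  constructor
  · rintro ⟨x, hx, y, hy, hlt⟩
    have hcont : Continuous fun q : S => ⟪mulE A (q : Euc m × Euc n).1, (q : Euc m × Euc n).2⟫_ℝ :=
      Continuous.inner ((LinearMap.continuous_of_finiteDimensional
        (Matrix.toEuclideanLin A)).comp (by fun_prop)) (by fun_prop)
    exact (TopologicalSpace.denseRange_denseSeq S).exists_mem_open
      (isOpen_lt continuous_const hcont) ⟨⟨(x, y), hx, hy⟩, hlt⟩
  · rintro ⟨i, hi⟩
    have hmem := (TopologicalSpace.denseSeq S i).2
    exact ⟨_, hmem.1, _, hmem.2, hi⟩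

theorem continuous_inner_mulE {m n : ℕ} (x : Euc m) (y : Euc n) :
    Continuous fun A : Fin n → Fin m → ℝ => ⟪mulE (Matrix.of A) x, y⟫_ℝ := by
  simp only [mulE, PiLp.inner_apply, Matrix.toLpLin_apply, Matrix.mulVec, dotProduct,
    Matrix.of_apply]
  fun_prop

theorem measurable_resNorm_add {m n : ℕ} {C : Set (Euc m)} {D : Set (Euc n)}
    (hC : IsClosedConvexCone C) (hCne : C ≠ {0}) (hD : IsClosedConvexCone D) :
    Measurable fun p : (Fin n → Fin m → ℝ) × ℝ => resNorm C D (Matrix.of p.1) + p.2 := by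
  obtain ⟨s, -, hs⟩ := exists_seq_lt_resNorm_add_iff hC hCne hD
  refine measurable_of_Ioi fun t => ?_
  have e : (fun p : (Fin n → Fin m → ℝ) × ℝ => resNorm C D (Matrix.of p.1) + p.2) ⁻¹' Ioi t =
      ⋃ i, {p | t < ⟪mulE (Matrix.of p.1) (s i).1, (s i).2⟫_ℝ + p.2} := by
    ext p
    simpa using hs (Matrix.of p.1) p.2 t
  rw [e]
  exact MeasurableSet.iUnion fun i => (isOpen_lt continuous_const
    (((continuous_inner_mulE _ _).comp continuous_fst).add continuous_snd)).measurableSet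

/-- Stochastic domination of `‖G‖_{C→D} + γ` by `‖Proj_D g'‖ + ‖Proj_C g‖`. -/
theorem measure_lt_resNorm_add_le {m n : ℕ} {C : Set (Euc m)} {D : Set (Euc n)}
    (hC : IsClosedConvexCone C) (hCne : C ≠ {0}) (hD : IsClosedConvexCone D) (t : ℝ) :
    ((stdGaussianPi n m).prod (gaussianReal 0 1)) {p | t < resNorm C D (Matrix.of p.1) + p.2} ≤
      ((stdGaussianE n).prod (stdGaussianE m))
        {p | t < ‖metricProj D p.1‖ + ‖metricProj C p.2‖} := by
  obtain ⟨s, hmem, hs⟩ := exists_seq_lt_resNorm_add_iff hC hCne hD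
  have hunion : {p : (Fin n → Fin m → ℝ) × ℝ | t < resNorm C D (Matrix.of p.1) + p.2} =
      ⋃ N : ℕ, {p | ∃ i : Fin N, t < ⟪mulE (Matrix.of p.1) (s i).1, (s i).2⟫_ℝ + p.2} := by
    ext p
    simp only [mem_ofPred_eq, hs, mem_iUnion]
    exact ⟨fun ⟨i, hi⟩ => ⟨i + 1, ⟨i, i.lt_succ_self⟩, hi⟩, fun ⟨_, i, hi⟩ => ⟨i, hi⟩⟩
  have hmono : Monotone fun N : ℕ => {p : (Fin n → Fin m → ℝ) × ℝ |
      ∃ i : Fin N, t < ⟪mulE (Matrix.of p.1) (s i).1, (s i).2⟫_ℝ + p.2} :=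
    fun _ _ hNM _ ⟨i, hi⟩ => ⟨i.castLE hNM, hi⟩
  rw [hunion, hmono.measure_iUnion]
  refine iSup_le fun N => (measure_exists_inner_gt_le (fun i : Fin N => s i)
    (fun i => mem_sphere_zero_iff_norm.1 (hmem i).1.2)
    (fun i => mem_closedBall_zero_iff.1 (hmem i).2.2) t).trans (measure_mono ?_)
  rintro p ⟨i, hi⟩
  exact hi.trans_le (add_le_add
    (inner_le_norm_metricProj hD _ (hmem i).2.1 (mem_closedBall_zero_iff.1 (hmem i).2.2))
    (inner_le_norm_metricProj hC _ (hmem i).1.1 (mem_sphere_zero_iff_norm.1 (hmem i).1.2).le))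

/-- For closed convex cones `C ≠ {0}`, `D`, a standard Gaussian matrix `G`, an
independent standard Gaussian `γ`, independent standard Gaussian vectors `g, g'`, and a
monotone Borel `f` with both sides integrable,
`E[f(‖G‖_{C→D} + γ)] ≤ E[f(‖Proj_D g'‖ + ‖Proj_C g‖)]`. -/
theorem statement1 {m n : ℕ} (C : Set (Euc m)) (D : Set (Euc n))
    (hC : IsClosedConvexCone C) (hCne : C ≠ {0}) (hD : IsClosedConvexCone D)
    (f : ℝ → ℝ) (hf_meas : Measurable f) (hf_mono : Monotone f)
    (hint1 : Integrable
      (fun p : (Fin n → Fin m → ℝ) × ℝ => f (resNorm C D (Matrix.of p.1) + p.2))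
      ((stdGaussianPi n m).prod (gaussianReal 0 1)))
    (hint2 : Integrable
      (fun p : Euc n × Euc m => f (‖metricProj D p.1‖ + ‖metricProj C p.2‖))
      ((stdGaussianE n).prod (stdGaussianE m))) :
    ∫ p, f (resNorm C D (Matrix.of p.1) + p.2)
        ∂((stdGaussianPi n m).prod (gaussianReal 0 1))
      ≤ ∫ p, f (‖metricProj D p.1‖ + ‖metricProj C p.2‖)
          ∂((stdGaussianE n).prod (stdGaussianE m)) := by
  have hM := measurable_resNorm_add hC hCne hD
  have hW : Measurable fun p : Euc n × Euc m => ‖metricProj D p.1‖ + ‖metricProj C p.2‖ :=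
    (((continuous_norm_metricProj hD).comp continuous_fst).add
      ((continuous_norm_metricProj hC).comp continuous_snd)).measurable
  have := Measure.isProbabilityMeasure_map
    (μ := (stdGaussianPi n m).prod (gaussianReal 0 1)) hM.aemeasurable
  have := Measure.isProbabilityMeasure_map
    (μ := (stdGaussianE n).prod (stdGaussianE m)) hW.aemeasurable
  rw [← integral_map hM.aemeasurable hf_meas.aestronglyMeasurable,
    ← integral_map hW.aemeasurable hf_meas.aestronglyMeasurable]
  refine integral_mono_of_measure_Ioi_le (fun t => ?_) hf_mono
    ((integrable_map_measure hf_meas.aestronglyMeasurable hM.aemeasurable).2 hint1)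
    ((integrable_map_measure hf_meas.aestronglyMeasurable hW.aemeasurable).2 hint2)
  rw [Measure.map_apply hM measurableSet_Ioi, Measure.map_apply hW measurableSet_Ioi]
  exact measure_lt_resNorm_add_le hC hCne hD t

end
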